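/- arXiv:nlin/0506042 — 8 statements merged into one kernel-verified Lean document; each statement's English description precedes it below -/
import Mathlib

section
/- Let T > 0, let m_1, …, m_N > 0 satisfy Σ_{i=1}^N m_i = 1, let L : ℝ → ℝ be strictly convex, and let y_1, …, y_N : [0,T] → ℝ be absolutely continuous with y_i(0) = y_i(T). Suppose that for some absolutely continuous x : [0,T] → ℝ equality holds in Jensen's inequality, namely T⁻¹ ∫₀ᵀ Σ_{i=1}^N m_i L(ẏ_i(t) + ẋ(t)) dt = L( T⁻¹ ∫₀ᵀ ẋ(t) dt ). Then there is a constant c ∈ ℝ such that ẏ_i(t) + ẋ(t) = c for almost every t ∈ [0,T] and every i; in particular ẏ_i = ẏ_j almost everywhere for all 1 ≤ i, j ≤ N. Consequently, for a strictly convex L, a mobilized system has efficiency e_L < 1. -/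
open MeasureTheory intervalIntegral

/-- A strictly convex function on the real line lies strictly above a supporting line, except at
the point of contact. -/
lemma StrictConvexOn.exists_lt_of_ne {L : ℝ → ℝ} (hL : StrictConvexOn ℝ Set.univ L) (c : ℝ) :
    ∃ a : ℝ, ∀ z, z ≠ c → L c + a * (z - c) < L z := by
  have hc : c ∈ interior (Set.univ : Set ℝ) := by simp
  refine ⟨derivWithin L (Set.Ioi c) c, fun z hz => ?_⟩
  rcases lt_or_gt_of_ne hz with h | h
  · have hslope := (hL.slope_lt_leftDeriv (Set.mem_univ z) (Set.mem_univ c) h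
      (hL.convexOn.hasDerivWithinAt_leftDeriv_of_mem_interior hc).differentiableWithinAt).trans_le
      (hL.convexOn.leftDeriv_le_rightDeriv_of_mem_interior hc)
    rw [slope_def_field, div_lt_iff₀ (sub_pos.2 h)] at hslope
    linarith
  · have hslope := hL.rightDeriv_lt_slope (Set.mem_univ c) (Set.mem_univ z) h
      (hL.convexOn.hasDerivWithinAt_rightDeriv_of_mem_interior hc).differentiableWithinAt
    rw [slope_def_field, lt_div_iff₀ (sub_pos.2 h)] at hslope
    linarith

/-- For a strictly convex Lagrangian `L`, equality in Jensen's
inequality for the action forces `ẏᵢ(t) + ẋ(t)` to be a constant `c` for a.e. `t`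
and every `i`; in particular `ẏᵢ = ẏⱼ` almost everywhere for all `i, j`. -/
theorem strict_convexity_equality_case
    (N : ℕ) (T : ℝ) (hT : 0 < T)
    (m : Fin N → ℝ) (hm : ∀ i, 0 < m i) (hsum : ∑ i, m i = 1)
    (L : ℝ → ℝ) (hL : StrictConvexOn ℝ Set.univ L)
    (y y' : Fin N → ℝ → ℝ)
    (hFTC : ∀ i t, y i t = y i 0 + ∫ s in (0:ℝ)..t, y' i s)
    (hyint : ∀ i, IntervalIntegrable (y' i) volume 0 T)
    (hper : ∀ i, y i 0 = y i T)
    (x x' : ℝ → ℝ)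
    (hxFTC : ∀ t, x t = x 0 + ∫ s in (0:ℝ)..t, x' s)
    (hxint : IntervalIntegrable x' volume 0 T)
    (hint : IntervalIntegrable (fun t => ∑ i, m i * L (y' i t + x' t)) volume 0 T)
    (heq : T⁻¹ * ∫ t in (0:ℝ)..T, ∑ i, m i * L (y' i t + x' t)
      = L (T⁻¹ * ∫ t in (0:ℝ)..T, x' t)) :
    (∃ c : ℝ, ∀ i, ∀ᵐ t ∂(volume.restrict (Set.Ioc 0 T)), y' i t + x' t = c) ∧
    (∀ i j, ∀ᵐ t ∂(volume.restrict (Set.Ioc 0 T)), y' i t = y' j t) := by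
  suffices h : ∃ c : ℝ, ∀ i, ∀ᵐ t ∂(volume.restrict (Set.Ioc 0 T)), y' i t + x' t = c by
    refine ⟨h, fun i j => ?_⟩
    obtain ⟨c, hc⟩ := h
    filter_upwards [hc i, hc j] with t hi hj
    linarith
  set c : ℝ := T⁻¹ * ∫ t in (0:ℝ)..T, x' t with hc
  obtain ⟨a, ha⟩ := hL.exists_lt_of_ne c
  have ha' (z : ℝ) : 0 ≤ L z - (L c + a * (z - c)) := by
    rcases eq_or_ne z c with rfl | hz
    · simp
    · exact sub_nonneg.2 (ha z hz).le
  have hy0 (i) : ∫ t in (0:ℝ)..T, y' i t = 0 := by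
    have h := hFTC i T
    rw [← hper i] at h
    linarith
  have hsumint : IntervalIntegrable (fun t => ∑ i, m i * y' i t) volume 0 T := by
    simpa only [Finset.sum_fn] using
      IntervalIntegrable.sum Finset.univ fun i _ => (hyint i).const_mul (m i)
  have hsum0 : ∫ t in (0:ℝ)..T, ∑ i, m i * y' i t = 0 := by
    rw [intervalIntegral.integral_finsetSum fun i _ => (hyint i).const_mul (m i)]
    simp [hy0]
  have hexcess (t : ℝ) : ∑ i, m i * (L (y' i t + x' t) - (L c + a * (y' i t + x' t - c)))
      = (∑ i, m i * L (y' i t + x' t)) - (a * ((∑ i, m i * y' i t) + x' t) + (L c - a * c)) := by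
    have hterm (i) : m i * (L (y' i t + x' t) - (L c + a * (y' i t + x' t - c)))
        = m i * L (y' i t + x' t) - a * (m i * y' i t)
          - m i * (a * x' t + (L c - a * c)) := by ring
    simp only [hterm, Finset.sum_sub_distrib, ← Finset.mul_sum, ← Finset.sum_mul, hsum]
    ring
  have hlin := (hsumint.add hxint).const_mul a
  have haff := hlin.add (intervalIntegrable_const (c := L c - a * c) (a := 0) (b := T)
    (μ := volume))
  have hzero : ∫ t in (0:ℝ)..T,
      ∑ i, m i * (L (y' i t + x' t) - (L c + a * (y' i t + x' t - c))) = 0 := by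
    simp only [hexcess]
    rw [integral_sub hint haff, integral_add hlin intervalIntegrable_const,
      intervalIntegral.integral_const_mul, integral_add hsumint hxint, hsum0,
      intervalIntegral.integral_const]
    have hx : ∫ t in (0:ℝ)..T, x' t = T * c := by rw [hc]; field_simp
    have hA : ∫ t in (0:ℝ)..T, ∑ i, m i * L (y' i t + x' t) = T * L c := by
      rw [← heq]; field_simp
    rw [hx, hA, smul_eq_mul]
    ring
  have hnonneg (t : ℝ) (i) :
      0 ≤ m i * (L (y' i t + x' t) - (L c + a * (y' i t + x' t - c))) :=
    mul_nonneg (hm i).le (ha' _)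
  rw [integral_eq_zero_iff_of_le_of_nonneg_ae hT.le
    (Filter.Eventually.of_forall fun t => Finset.sum_nonneg fun i _ => hnonneg t i)
    (by simpa only [hexcess] using hint.sub haff)] at hzero
  refine ⟨c, fun i => ?_⟩
  filter_upwards [hzero] with t ht
  by_contra hne
  have hi := (Finset.sum_eq_zero_iff_of_nonneg fun i _ => hnonneg t i).1 ht i (Finset.mem_univ i)
  exact (mul_pos (hm i) (sub_pos.2 (ha _ hne))).ne' hi
end

section
/- The function u : ℝ^N → ℝ is continuous, and there exists a constant A > 0 such that |u(v)| ≤ A·|v| for all v ∈ ℝ^N. -/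
/-- The weighted cost is strictly increasing in the sizes of all the entries. -/
theorem sum_mul_abs_add_rpow_lt {N : ℕ} (hN : 1 ≤ N) {σ : ℝ} (hσ : 0 < σ)
    {m : Fin N → ℝ} (hm : ∀ i, 0 < m i) {v : Fin N → ℝ} {x y : ℝ}
    (hxy : ∀ i, |v i + x| < |v i + y|) :
    ∑ i, m i * |v i + x| ^ σ < ∑ i, m i * |v i + y| ^ σ := by
  refine Finset.sum_lt_sum_of_nonempty ⟨⟨0, hN⟩, Finset.mem_univ _⟩ fun i _ => ?_
  exact mul_lt_mul_of_pos_left (Real.rpow_lt_rpow (abs_nonneg _) (hxy i) hσ) (hm i)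

/-- A minimizer of the weighted cost is bounded by the sup norm of the data. -/
theorem abs_minimizer_le_norm {N : ℕ} (hN : 1 ≤ N) {σ : ℝ} (hσ : 0 < σ)
    {m : Fin N → ℝ} (hm : ∀ i, 0 < m i) {v : Fin N → ℝ} {x : ℝ}
    (hx : ∀ ξ, ∑ i, m i * |v i + x| ^ σ ≤ ∑ i, m i * |v i + ξ| ^ σ) :
    |x| ≤ ‖v‖ := by
  have hv i : -‖v‖ ≤ v i ∧ v i ≤ ‖v‖ := abs_le.mp (norm_le_pi_norm v i)
  rw [abs_le]
  constructor
  · by_contra! h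
    refine (hx (-‖v‖)).not_gt (sum_mul_abs_add_rpow_lt hN hσ hm fun i => ?_)
    have := hv i
    rw [abs_of_nonpos (by linarith), abs_of_nonpos (by linarith)]
    linarith
  · by_contra! h
    refine (hx ‖v‖).not_gt (sum_mul_abs_add_rpow_lt hN hσ hm fun i => ?_)
    have := hv i
    rw [abs_of_nonneg (by linarith), abs_of_nonneg (by linarith)]
    linarith

/-- The minimizer function `u : ℝᴺ → ℝ` is continuous and linearly
bounded: there is `A > 0` with `|u(v)| ≤ A |v|` for all `v` (Euclidean norm). -/
theorem minimizer_continuous_and_linearly_bounded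
    (N : ℕ) (hN : 1 ≤ N) (σ : ℝ) (hσ : 1 < σ)
    (m : Fin N → ℝ) (hm : ∀ i, 0 < m i) (hsum : ∑ i, m i = 1)
    (u : (Fin N → ℝ) → ℝ)
    (hu : ∀ v ξ, ∑ i, m i * |v i + u v| ^ σ ≤ ∑ i, m i * |v i + ξ| ^ σ)
    (huniq : ∀ v ξ, (∀ ζ, ∑ i, m i * |v i + ξ| ^ σ ≤ ∑ i, m i * |v i + ζ| ^ σ) → ξ = u v) :
    Continuous u ∧
    ∃ A : ℝ, 0 < A ∧ ∀ v : Fin N → ℝ, |u v| ≤ A * Real.sqrt (∑ i, (v i) ^ 2) := by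
  have hσ0 : 0 < σ := by linarith
  have hbound v : |u v| ≤ ‖v‖ := abs_minimizer_le_norm hN hσ0 hm (hu v)
  constructor
  · rw [continuous_iff_continuousAt]
    intro v
    refine (isCompact_closedBall (0 : ℝ) (‖v‖ + 1)).tendsto_nhds_of_unique_mapClusterPt ?_ ?_
    · filter_upwards [(continuous_norm.tendsto v).eventually_lt_const (lt_add_one ‖v‖)] with w hw
      rw [mem_closedBall_zero_iff, Real.norm_eq_abs]
      exact (hbound w).trans hw.le
    · intro x _ hx
      obtain ⟨U, hU, hUx⟩ := mapClusterPt_iff_ultrafilter.mp hx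
      have hcost {f : (Fin N → ℝ) → ℝ} {a : ℝ} (hf : Filter.Tendsto f U (nhds a)) :
          Filter.Tendsto (fun w => ∑ i, m i * |w i + f w| ^ σ) U
            (nhds (∑ i, m i * |v i + a| ^ σ)) := by
        refine tendsto_finsetSum _ fun i _ => Filter.Tendsto.const_mul _ ?_
        exact ((((continuous_apply i).tendsto v).mono_left hU).add hf).abs.rpow_const
          (Or.inr hσ0.le)
      exact huniq v x fun ζ =>
        le_of_tendsto_of_tendsto' (hcost hUx) (hcost tendsto_const_nhds) fun w => hu w ζ
  · refine ⟨1, one_pos, fun v => ?_⟩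
    rw [one_mul]
    refine (hbound v).trans ((pi_norm_le_iff_of_nonneg (Real.sqrt_nonneg _)).mpr fun i => ?_)
    exact Real.abs_le_sqrt
      (Finset.single_le_sum (f := fun j => v j ^ 2) (fun j _ => sq_nonneg _) (Finset.mem_univ i))
end

section
/- If N = 2, then for every σ > 1 and all weights m_1, m_2 > 0 with m_1 + m_2 = 1, the function u : ℝ² → ℝ is linear: there exist constants a, b ∈ ℝ such that u(v_1, v_2) = a v_1 + b v_2 for all (v_1, v_2) ∈ ℝ². Consequently, a homogeneous mechanical system with N = 2 parts is never mobilized. -/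
open MeasureTheory intervalIntegral

/-- Affine covariance of the two-term energy: substituting `ξ = (x - y) * η - y` factors out
`|x - y| ^ σ`. -/
lemma weighted_abs_rpow_affine (σ m₁ m₂ x y η : ℝ) :
    m₁ * |x + ((x - y) * η - y)| ^ σ + m₂ * |y + ((x - y) * η - y)| ^ σ
      = |x - y| ^ σ * (m₁ * |1 + η| ^ σ + m₂ * |0 + η| ^ σ) := by
  rw [show x + ((x - y) * η - y) = (x - y) * (1 + η) by ring,
    show y + ((x - y) * η - y) = (x - y) * (0 + η) by ring, abs_mul, abs_mul,
    Real.mul_rpow (abs_nonneg _) (abs_nonneg _), Real.mul_rpow (abs_nonneg _) (abs_nonneg _)]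
  ring

/-- A minimizer `c` for the data `(1, 0)` yields the minimizer `(x - y) * c - y` for `(x, y)`. -/
lemma weighted_abs_rpow_minimizer {σ m₁ m₂ c : ℝ} (hσ : σ ≠ 0) (hm₁ : 0 ≤ m₁) (hm₂ : 0 ≤ m₂)
    (hc : ∀ η : ℝ, m₁ * |1 + c| ^ σ + m₂ * |0 + c| ^ σ
      ≤ m₁ * |1 + η| ^ σ + m₂ * |0 + η| ^ σ) (x y ζ : ℝ) :
    m₁ * |x + ((x - y) * c - y)| ^ σ + m₂ * |y + ((x - y) * c - y)| ^ σ
      ≤ m₁ * |x + ζ| ^ σ + m₂ * |y + ζ| ^ σ := by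
  rw [weighted_abs_rpow_affine]
  by_cases hd : x - y = 0
  · rw [hd, abs_zero, Real.zero_rpow hσ, zero_mul]
    positivity
  · have hζ : ζ = (x - y) * ((ζ + y) / (x - y)) - y := by
      rw [mul_div_cancel₀ _ hd]; ring
    rw [hζ, weighted_abs_rpow_affine]
    exact mul_le_mul_of_nonneg_left (hc _) (by positivity)

/-- For `N = 2` parts the minimizer function `u` of
`ξ ↦ m₁|v₁ + ξ|^σ + m₂|v₂ + ξ|^σ` is linear: `u(v) = a v₁ + b v₂` for some constants
`a, b`. Consequently a homogeneous system with two parts is never mobilized: for every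
absolutely continuous `1`-periodic curve `y` with `ẏ ∈ L^σ`, `∫₀¹ u(ẏ(t)) dt = 0`. -/
theorem two_part_system_minimizer_linear_not_mobilized
    (σ : ℝ) (hσ : 1 < σ)
    (m₁ m₂ : ℝ) (hm₁ : 0 < m₁) (hm₂ : 0 < m₂) (hsum : m₁ + m₂ = 1)
    (u : (Fin 2 → ℝ) → ℝ)
    (hu : ∀ (v : Fin 2 → ℝ) (ξ : ℝ),
      m₁ * |v 0 + u v| ^ σ + m₂ * |v 1 + u v| ^ σ
        ≤ m₁ * |v 0 + ξ| ^ σ + m₂ * |v 1 + ξ| ^ σ)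
    (huniq : ∀ (v : Fin 2 → ℝ) (ξ : ℝ),
      (∀ ζ : ℝ, m₁ * |v 0 + ξ| ^ σ + m₂ * |v 1 + ξ| ^ σ
        ≤ m₁ * |v 0 + ζ| ^ σ + m₂ * |v 1 + ζ| ^ σ) → ξ = u v) :
    (∃ a b : ℝ, ∀ v : Fin 2 → ℝ, u v = a * v 0 + b * v 1) ∧
    (∀ y y' : ℝ → Fin 2 → ℝ,
      (∀ t, y t = y 0 + ∫ s in (0:ℝ)..t, y' s) →
      y 1 = y 0 →
      IntervalIntegrable y' volume 0 1 →
      IntegrableOn (fun t => (Real.sqrt ((y' t 0) ^ 2 + (y' t 1) ^ 2)) ^ σ)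
        (Set.Ioc (0:ℝ) 1) →
      ∫ t in (0:ℝ)..1, u (y' t) = 0) := by
  have hlin : ∀ v : Fin 2 → ℝ, u v = u ![1, 0] * v 0 + (-u ![1, 0] - 1) * v 1 := by
    intro v
    rw [← huniq v _ (weighted_abs_rpow_minimizer (by linarith) hm₁.le hm₂.le
      (fun η => by simpa using hu ![1, 0] η) (v 0) (v 1))]
    ring
  refine ⟨⟨_, _, hlin⟩, fun y y' hy hper hint _ => ?_⟩
  have hzero : ∫ t in (0 : ℝ)..1, y' t = 0 := by
    simpa [hper] using hy 1
  let T : (Fin 2 → ℝ) →L[ℝ] ℝ :=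
    u ![1, 0] • ContinuousLinearMap.proj 0 + (-u ![1, 0] - 1) • ContinuousLinearMap.proj 1
  have hT : ∀ v, u v = T v := fun v => by rw [hlin v]; simp [T]
  simp_rw [hT]
  rw [T.intervalIntegral_comp_comm hint, hzero, map_zero]
end

section
/- Suppose u : ℝ^N → ℝ is not linear (i.e. there is no vector c ∈ ℝ^N with u(v) = Σ_i c_i v_i for all v). Then there exists an absolutely continuous curve y : [0,1] → ℝ^N with y(0) = y(1) and ∫₀¹ |ẏ(t)|^σ dt < ∞ such that ∫₀¹ u(ẏ(t)) dt ≠ 0; i.e. the homogeneous system is mobilized. -/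
open MeasureTheory intervalIntegral

/-- The step function with values `a`, `b`, `c` on the consecutive thirds of `(0, 1]`. -/
noncomputable def thirdsStep {E : Type*} (a b c : E) (t : ℝ) : E :=
  if t ≤ 1 / 3 then a else if t ≤ 2 / 3 then b else c

theorem comp_thirdsStep {E F : Type*} (f : E → F) (a b c : E) (t : ℝ) :
    f (thirdsStep a b c t) = thirdsStep (f a) (f b) (f c) t := by
  simp only [thirdsStep, apply_ite f]

theorem intervalIntegrable_and_integral_thirdsStep {E : Type*} [NormedAddCommGroup E]
    [NormedSpace ℝ E] [CompleteSpace E] (a b c : E) :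
    IntervalIntegrable (thirdsStep a b c) volume 0 1 ∧
      ∫ t in (0 : ℝ)..1, thirdsStep a b c t = (1 / 3 : ℝ) • (a + b + c) := by
  have piece : ∀ (p q : ℝ) (e : E), p ≤ q →
      (∀ t ∈ Set.Ioc p q, thirdsStep a b c t = e) →
      IntervalIntegrable (thirdsStep a b c) volume p q ∧
        ∫ t in p..q, thirdsStep a b c t = (q - p) • e := by
    intro p q e hpq h
    rw [← Set.uIoc_of_le hpq] at h
    constructor
    · exact (intervalIntegrable_const (c := e)).congr fun t ht => (h t ht).symm
    · rw [integral_congr_ae (Filter.Eventually.of_forall h), intervalIntegral.integral_const]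
  obtain ⟨ha, ha'⟩ := piece 0 (1 / 3) a (by norm_num) fun t ht => if_pos ht.2
  obtain ⟨hb, hb'⟩ := piece (1 / 3) (2 / 3) b (by norm_num) fun t ht => by
    rw [thirdsStep, if_neg ht.1.not_ge, if_pos ht.2]
  obtain ⟨hc, hc'⟩ := piece (2 / 3) 1 c (by norm_num) fun t ht => by
    rw [thirdsStep, if_neg (by linarith [ht.1]), if_neg ht.1.not_ge]
  refine ⟨(ha.trans hb).trans hc, ?_⟩
  rw [← integral_add_adjacent_intervals (ha.trans hb) hc,
    ← integral_add_adjacent_intervals ha hb, ha', hb', hc']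
  norm_num [smul_add]

/-- The minimizer of a weighted power sum `ξ ↦ ∑ i, m i * |v i + ξ| ^ σ` is homogeneous in `v`. -/
theorem minimizer_smul {ι : Type*} [Fintype ι] {σ : ℝ} (hσ : 0 < σ) {m : ι → ℝ}
    (hm : ∀ i, 0 ≤ m i) {u : (ι → ℝ) → ℝ}
    (hu : ∀ v ξ, ∑ i, m i * |v i + u v| ^ σ ≤ ∑ i, m i * |v i + ξ| ^ σ)
    (huniq : ∀ v ξ, (∀ ζ, ∑ i, m i * |v i + ξ| ^ σ ≤ ∑ i, m i * |v i + ζ| ^ σ) → ξ = u v)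
    (r : ℝ) (v : ι → ℝ) : u (r • v) = r * u v := by
  refine (huniq _ _ fun ζ => ?_).symm
  have scale : ∀ ξ, ∑ i, m i * |(r • v) i + r * ξ| ^ σ = |r| ^ σ * ∑ i, m i * |v i + ξ| ^ σ := by
    intro ξ
    rw [Finset.mul_sum]
    refine Finset.sum_congr rfl fun i _ => ?_
    rw [Pi.smul_apply, smul_eq_mul, ← mul_add, abs_mul,
      Real.mul_rpow (abs_nonneg _) (abs_nonneg _)]
    ring
  rw [scale]
  rcases eq_or_ne r 0 with rfl | hr
  · rw [abs_zero, Real.zero_rpow hσ.ne', zero_mul]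
    exact Finset.sum_nonneg fun i _ => mul_nonneg (hm i) (Real.rpow_nonneg (abs_nonneg _) _)
  · rw [← mul_div_cancel₀ ζ hr, scale]
    exact mul_le_mul_of_nonneg_left (hu _ _) (Real.rpow_nonneg (abs_nonneg _) _)

/-- If the minimizer function `u` is not linear, then there exists an
absolutely continuous `1`-periodic curve `y : [0,1] → ℝᴺ` with `ẏ ∈ L^σ` such that
`∫₀¹ u(ẏ(t)) dt ≠ 0`: the homogeneous system is mobilized. -/
theorem mobilized_of_nonlinear_minimizer
    (N : ℕ) (hN : 1 ≤ N) (σ : ℝ) (hσ : 1 < σ)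
    (m : Fin N → ℝ) (hm : ∀ i, 0 < m i) (hsum : ∑ i, m i = 1)
    (u : (Fin N → ℝ) → ℝ)
    (hu : ∀ v ξ, ∑ i, m i * |v i + u v| ^ σ ≤ ∑ i, m i * |v i + ξ| ^ σ)
    (huniq : ∀ v ξ, (∀ ζ, ∑ i, m i * |v i + ξ| ^ σ ≤ ∑ i, m i * |v i + ζ| ^ σ) → ξ = u v)
    (hnlin : ¬ ∃ c : Fin N → ℝ, ∀ v, u v = ∑ i, c i * v i) :
    ∃ y y' : ℝ → Fin N → ℝ,
      (∀ t, y t = y 0 + ∫ s in (0:ℝ)..t, y' s) ∧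
      y 1 = y 0 ∧
      IntervalIntegrable y' volume 0 1 ∧
      IntegrableOn (fun t => (Real.sqrt (∑ i, (y' t i) ^ 2)) ^ σ) (Set.Ioc (0:ℝ) 1) ∧
      ∫ t in (0:ℝ)..1, u (y' t) ≠ 0 := by
  have hsmul := minimizer_smul (by linarith) (fun i => (hm i).le) hu huniq
  by_contra hcon
  have hzero : ∀ a b c : Fin N → ℝ, a + b + c = 0 → u a + u b + u c = 0 := by
    intro a b c habc
    by_contra hne
    obtain ⟨hint, hval⟩ := intervalIntegrable_and_integral_thirdsStep a b c
    refine hcon ⟨fun t => ∫ s in (0 : ℝ)..t, thirdsStep a b c s, thirdsStep a b c,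
      fun t => by simp, by simp [hval, habc], hint, ?_, ?_⟩
    · rw [← intervalIntegrable_iff_integrableOn_Ioc_of_le zero_le_one]
      simp_rw [comp_thirdsStep (fun w : Fin N → ℝ => Real.sqrt (∑ i, (w i) ^ 2) ^ σ)]
      exact (intervalIntegrable_and_integral_thirdsStep _ _ _).1
    · simp_rw [comp_thirdsStep u]
      rw [(intervalIntegrable_and_integral_thirdsStep _ _ _).2]
      exact smul_ne_zero (by norm_num) hne
  have hadd : ∀ a b, u (a + b) = u a + u b := by
    intro a b
    have h := hzero a b ((-1 : ℝ) • (a + b)) (by module)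
    rw [hsmul] at h
    linarith
  let f : (Fin N → ℝ) →ₗ[ℝ] ℝ := { toFun := u, map_add' := hadd, map_smul' := hsmul }
  refine hnlin ⟨fun i => f (Pi.single i 1), fun v => ?_⟩
  change f v = _
  rw [LinearMap.pi_apply_eq_sum_univ f v]
  refine Finset.sum_congr rfl fun i _ => ?_
  rw [smul_eq_mul, mul_comm]
  congr 2
  ext j
  simp [Pi.single_apply, eq_comm]
end

section
/- Let y ∈ Λ_σ, extend y to all of ℝ by y(t + 1) = y(t) + (y(1) − y(0)) = y(t), and for each integer j ≥ 1 define y_j(t) := j⁻¹ y(jt) for t ∈ [0,1]. Then: (a) y_j ∈ Λ_σ for every j; (b) y_j → 0 uniformly on [0,1] as j → ∞; (c) ∫₀¹ u(ẏ_j(t)) dt = ∫₀¹ u(ẏ(t)) dt for every j; (d) D(y_j) = D(y) for every j, and hence e_σ(y_j) = e_σ(y) whenever D(y) > 0. In particular, a maximizing sequence of the efficiency may converge weakly to the zero curve, on which the efficiency is undefined. -/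
open MeasureTheory intervalIntegral Filter

section PeriodicSpeedup

variable {E : Type*} [NormedAddCommGroup E] {f : ℝ → E} {j : ℕ}

theorem intervalIntegrable_comp_natCast_mul_iff_of_periodic_one
    (hf : Function.Periodic f 1) (hj : 1 ≤ j) :
    IntervalIntegrable (fun t => f (j * t)) volume 0 1 ↔ IntervalIntegrable f volume 0 1 := by
  have hj0 : (j : ℝ) ≠ 0 := by positivity
  have hscale := IntervalIntegrable.comp_mul_left_iff (f := f) (a := 0) (b := j) hj0
  rw [zero_div, div_self hj0] at hscale
  rw [hscale]
  refine ⟨fun h => h.mono_set ?_, fun h => hf.intervalIntegrable₀ one_ne_zero h _ _⟩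
  rw [Set.uIcc_of_le zero_le_one, Set.uIcc_of_le (Nat.cast_nonneg j)]
  exact Set.Icc_subset_Icc_right (by exact_mod_cast hj)

/-- No integrability is assumed: both sides vanish if `f` is not integrable over a period. -/
theorem intervalIntegral_comp_natCast_mul_of_periodic_one [NormedSpace ℝ E]
    (hf : Function.Periodic f 1) (hj : 1 ≤ j) :
    ∫ t in (0:ℝ)..1, f (j * t) = ∫ t in (0:ℝ)..1, f t := by
  have hj0 : (j : ℝ) ≠ 0 := by positivity
  by_cases hint : IntervalIntegrable f volume 0 1
  · have h := hf.intervalIntegral_add_zsmul_eq (j : ℤ) 0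
      (hf.intervalIntegrable₀ one_ne_zero hint)
    simp only [zero_add, zsmul_eq_mul, Int.cast_natCast, mul_one] at h
    rw [integral_comp_mul_left _ hj0, mul_zero, mul_one, h, natCast_zsmul,
      ← Nat.cast_smul_eq_nsmul ℝ, smul_smul, inv_mul_cancel₀ hj0, one_smul]
  · rw [integral_undef hint, integral_undef
      (mt (intervalIntegrable_comp_natCast_mul_iff_of_periodic_one hf hj).1 hint)]

end PeriodicSpeedup

theorem tendstoUniformlyOn_inv_smul_comp_natCast_mul_of_isBounded_range
    {E : Type*} [NormedAddCommGroup E] [NormedSpace ℝ E] {f : ℝ → E}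
    (hf : Bornology.IsBounded (Set.range f)) (s : Set ℝ) :
    TendstoUniformlyOn (fun (j : ℕ) (t : ℝ) => (j : ℝ)⁻¹ • f (j * t))
      (fun _ => (0 : E)) atTop s := by
  obtain ⟨C, hC⟩ := hf.exists_norm_le
  have hlim : Tendsto (fun j : ℕ => (j : ℝ)⁻¹ * C) atTop (nhds 0) := by
    simpa using (tendsto_inv_atTop_nhds_zero_nat (𝕜 := ℝ)).mul_const C
  rw [Metric.tendstoUniformlyOn_iff]
  intro ε hε
  filter_upwards [hlim.eventually_lt_const hε] with j hj t _
  rw [dist_zero_left, norm_smul, norm_inv, Real.norm_natCast]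
  exact (mul_le_mul_of_nonneg_left (hC _ ⟨_, rfl⟩) (by positivity)).trans_lt hj

/-- Speeding up a periodic curve: extend `y ∈ Λ_σ` periodically to `ℝ`
and set `y_j(t) := j⁻¹ y(jt)`. Then (a) `y_j ∈ Λ_σ`, (b) `y_j → 0` uniformly on `[0,1]`,
(c) `∫₀¹ u(ẏ_j) dt = ∫₀¹ u(ẏ) dt`, (d) `D(y_j) = D(y)` and hence
`e_σ(y_j) = e_σ(y)` whenever `D(y) > 0`. -/
theorem speeding_up_periodic_curve
    (N : ℕ) (hN : 1 ≤ N) (σ : ℝ) (hσ : 1 < σ)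
    (m : Fin N → ℝ) (hm : ∀ i, 0 < m i) (hsum : ∑ i, m i = 1)
    (u : (Fin N → ℝ) → ℝ)
    (hu : ∀ v ξ, ∑ i, m i * |v i + u v| ^ σ ≤ ∑ i, m i * |v i + ξ| ^ σ)
    (huniq : ∀ v ξ, (∀ ζ, ∑ i, m i * |v i + ξ| ^ σ ≤ ∑ i, m i * |v i + ζ| ^ σ) → ξ = u v)
    (y y' : ℝ → Fin N → ℝ)
    (hFTC : ∀ t, y t = y 0 + ∫ s in (0:ℝ)..t, y' s)
    (hper : y 1 = y 0)
    (hy'per : ∀ t, y' (t + 1) = y' t)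
    (hint : IntervalIntegrable y' volume 0 1)
    (hLσ : IntegrableOn (fun t => (Real.sqrt (∑ i, (y' t i) ^ 2)) ^ σ) (Set.Ioc (0:ℝ) 1)) :
    (∀ j : ℕ, 1 ≤ j →
      -- (a) `y_j ∈ Λ_σ`
      ((∀ t : ℝ, (j:ℝ)⁻¹ • y (j * t) = (j:ℝ)⁻¹ • y (j * 0)
          + ∫ s in (0:ℝ)..t, y' (j * s)) ∧
        (j:ℝ)⁻¹ • y (j * 1) = (j:ℝ)⁻¹ • y (j * 0) ∧
        IntervalIntegrable (fun t => y' (j * t)) volume 0 1 ∧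
        IntegrableOn (fun t => (Real.sqrt (∑ i, (y' (j * t) i) ^ 2)) ^ σ)
          (Set.Ioc (0:ℝ) 1)) ∧
      -- (c) same mean velocity
      (∫ t in (0:ℝ)..1, u (y' (j * t))) = (∫ t in (0:ℝ)..1, u (y' t)) ∧
      -- (d) same dissipation, same efficiency
      (∫ t in (0:ℝ)..1, ∑ i, m i * |y' (j * t) i + u (y' (j * t))| ^ σ)
        = (∫ t in (0:ℝ)..1, ∑ i, m i * |y' t i + u (y' t)| ^ σ) ∧
      ((0 < ∫ t in (0:ℝ)..1, ∑ i, m i * |y' t i + u (y' t)| ^ σ) →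
        |∫ t in (0:ℝ)..1, u (y' (j * t))| ^ σ
            / (∫ t in (0:ℝ)..1, ∑ i, m i * |y' (j * t) i + u (y' (j * t))| ^ σ)
          = |∫ t in (0:ℝ)..1, u (y' t)| ^ σ
            / (∫ t in (0:ℝ)..1, ∑ i, m i * |y' t i + u (y' t)| ^ σ))) ∧
    -- (b) uniform convergence to the zero curve
    TendstoUniformlyOn (fun (j : ℕ) (t : ℝ) => (j:ℝ)⁻¹ • y (j * t))
      (fun _ => (0 : Fin N → ℝ)) atTop (Set.Icc (0:ℝ) 1) := by
  have hp : Function.Periodic y' 1 := hy'per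
  have hI := hp.intervalIntegrable₀ one_ne_zero hint
  have hzero : ∫ s in (0:ℝ)..1, y' s = 0 := by
    simpa [hper] using hFTC 1
  have hy : Function.Periodic y 1 := fun t => by
    rw [hFTC (t + 1), hFTC t, ← integral_add_adjacent_intervals (hI 0 t) (hI t (t + 1)),
      hp.intervalIntegral_add_eq t 0, zero_add, hzero, add_zero]
  have hcont : Continuous y := by
    rw [funext hFTC]
    exact continuous_const.add (continuous_primitive hI 0)
  refine ⟨fun j hj => ?_, tendstoUniformlyOn_inv_smul_comp_natCast_mul_of_isBounded_range
    (hy.isBounded_of_continuous one_ne_zero hcont) _⟩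
  have hj0 : (j : ℝ) ≠ 0 := by positivity
  have hmean := intervalIntegral_comp_natCast_mul_of_periodic_one (hp.comp u) hj
  have hdiss := intervalIntegral_comp_natCast_mul_of_periodic_one
    (hp.comp fun v => ∑ i, m i * |v i + u v| ^ σ) hj
  simp only [Function.comp_apply] at hmean hdiss
  refine ⟨⟨fun t => ?_, ?_, ?_, ?_⟩, hmean, hdiss, fun _ => by rw [hmean, hdiss]⟩
  · rw [integral_comp_mul_left _ hj0, mul_zero, hFTC (j * t), smul_add]
  · rw [hy.nat_mul_eq, mul_zero]
  · exact (intervalIntegrable_comp_natCast_mul_iff_of_periodic_one hp hj).2 hint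
  · rw [← intervalIntegrable_iff_integrableOn_Ioc_of_le zero_le_one] at hLσ ⊢
    exact (intervalIntegrable_comp_natCast_mul_iff_of_periodic_one
      (hp.comp fun v => Real.sqrt (∑ i, v i ^ 2) ^ σ) hj).2 hLσ
end

section
/- Let y ∈ Λ_σ and let ν be the Borel probability measure on ℝ^N obtained as the pushforward of Lebesgue measure on [0,1] under the map t ↦ ẏ(t). Then ν ∈ Λ̄_σ (i.e. ∫|v|^σ ν(dv) = ∫₀¹|ẏ|^σ dt < ∞ and ∫ v_i ν(dv) = 0 for each i), and moreover ∫ u(v) ν(dv) = ∫₀¹ u(ẏ(t)) dt and ∫ Σ_i m_i |v_i + u(v)|^σ ν(dv) = D(y); consequently e_σ(ν) = e_σ(y) whenever D(y) > 0. If in addition y_1 ≡ 0, then ν ∈ Λ̄⁰_σ. -/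
open MeasureTheory intervalIntegral

theorem convexOn_abs_rpow {σ : ℝ} (hσ : 1 ≤ σ) :
    ConvexOn ℝ Set.univ (fun x : ℝ => |x| ^ σ) := by
  refine ⟨convex_univ, fun x _ z _ a b ha hb hab => ?_⟩
  have hc := (convexOn_rpow hσ).2 (abs_nonneg x) (abs_nonneg z) ha hb hab
  refine le_trans (Real.rpow_le_rpow (abs_nonneg _) ?_ (by linarith)) hc
  simpa [abs_mul, abs_of_nonneg ha, abs_of_nonneg hb] using abs_add_le (a * x) (b * z)

theorem convexOn_sum_mul_abs_add_rpow {ι : Type*} [Fintype ι] {σ : ℝ} (hσ : 1 ≤ σ)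
    {m : ι → ℝ} (hm : ∀ i, 0 ≤ m i) (v : ι → ℝ) :
    ConvexOn ℝ Set.univ (fun ξ : ℝ => ∑ i, m i * |v i + ξ| ^ σ) := by
  refine ⟨convex_univ, fun x _ z _ a b ha hb hab => ?_⟩
  simp only [smul_eq_mul, Finset.mul_sum, ← Finset.sum_add_distrib]
  refine Finset.sum_le_sum fun i _ => ?_
  have hc := (convexOn_abs_rpow hσ).2 (Set.mem_univ (v i + x)) (Set.mem_univ (v i + z)) ha hb hab
  have he : v i + (a * x + b * z) = a * (v i + x) + b * (v i + z) := by
    linear_combination (-(v i)) * hab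
  simp only [smul_eq_mul] at hc
  rw [he]
  calc _ ≤ m i * (a * |v i + x| ^ σ + b * |v i + z| ^ σ) :=
        mul_le_mul_of_nonneg_left hc (hm i)
    _ = _ := by ring

/-- The unique minimizer in `ξ` of `∑ i, m i * |v i + ξ| ^ σ` depends measurably on `v`. -/
theorem measurable_argmin_sum_abs_rpow {ι : Type*} [Fintype ι] {σ : ℝ} (hσ : 1 ≤ σ)
    {m : ι → ℝ} (hm : ∀ i, 0 ≤ m i) {u : (ι → ℝ) → ℝ}
    (hu : ∀ v ξ, ∑ i, m i * |v i + u v| ^ σ ≤ ∑ i, m i * |v i + ξ| ^ σ)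
    (huniq : ∀ v ξ, (∀ ζ, ∑ i, m i * |v i + ξ| ^ σ ≤ ∑ i, m i * |v i + ζ| ^ σ) → ξ = u v) :
    Measurable u := by
  have hσ0 : 0 ≤ σ := zero_le_one.trans hσ
  refine measurable_of_Iio fun a => ?_
  have hset : u ⁻¹' Set.Iio a = ⋃ (q : ℚ) (_ : (q : ℝ) < a),
      {v : ι → ℝ | ∑ i, m i * |v i + (q : ℝ)| ^ σ < ∑ i, m i * |v i + a| ^ σ} := by
    ext v
    simp only [Set.mem_preimage, Set.mem_Iio, Set.mem_iUnion, Set.mem_ofPred_eq, exists_prop]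
    constructor
    · intro hlt
      have hL : ∑ i, m i * |v i + u v| ^ σ < ∑ i, m i * |v i + a| ^ σ := by
        by_contra! hle
        exact hlt.ne' (huniq v a fun ζ => hle.trans (hu v ζ))
      have hcont : Continuous fun ξ : ℝ => ∑ i, m i * |v i + ξ| ^ σ :=
        continuous_finsetSum _ fun i _ => continuous_const.mul
          ((continuous_const.add continuous_id).abs.rpow_const fun _ => Or.inr hσ0)
      have hopen : IsOpen ({ξ : ℝ | ∑ i, m i * |v i + ξ| ^ σ < ∑ i, m i * |v i + a| ^ σ} ∩
          Set.Iio a) := (isOpen_lt hcont continuous_const).inter isOpen_Iio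
      obtain ⟨q, hq⟩ := Rat.denseRange_cast.exists_mem_open hopen ⟨u v, hL, hlt⟩
      exact ⟨q, hq.2, hq.1⟩
    · rintro ⟨q, hqa, hq⟩
      by_contra! hle
      have hmax := (convexOn_sum_mul_abs_add_rpow hσ hm v).le_max_of_mem_Icc
        (Set.mem_univ (q : ℝ)) (Set.mem_univ (u v)) ⟨hqa.le, hle⟩
      rw [max_eq_left (hu v q)] at hmax
      exact hq.not_ge hmax
  rw [hset]
  refine MeasurableSet.iUnion fun q => MeasurableSet.iUnion fun _ => measurableSet_lt ?_ ?_ <;>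
    fun_prop

/-- (Young measure of a curve.) Let `y ∈ Λ_σ` and let `ν` be the
pushforward of Lebesgue measure on `[0,1]` under `t ↦ ẏ(t)`. Then `ν ∈ Λ̄_σ`
(`ν` is a probability measure with `∫ |v|^σ dν = ∫₀¹ |ẏ|^σ dt < ∞` and `∫ vᵢ dν = 0`),
`∫ u dν = ∫₀¹ u(ẏ) dt`, `∫ ∑ᵢ mᵢ|vᵢ + u(v)|^σ dν = D(y)`, hence
`e_σ(ν) = e_σ(y)` whenever `D(y) > 0`; and if `ẏ₁ ≡ 0` then `ν ∈ Λ̄⁰_σ`. -/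
theorem young_measure_of_curve
    (N : ℕ) (hN : 0 < N) (σ : ℝ) (hσ : 1 < σ)
    (m : Fin N → ℝ) (hm : ∀ i, 0 < m i) (hsum : ∑ i, m i = 1)
    (u : (Fin N → ℝ) → ℝ)
    (hu : ∀ v ξ, ∑ i, m i * |v i + u v| ^ σ ≤ ∑ i, m i * |v i + ξ| ^ σ)
    (huniq : ∀ v ξ, (∀ ζ, ∑ i, m i * |v i + ξ| ^ σ ≤ ∑ i, m i * |v i + ζ| ^ σ) → ξ = u v)
    (y y' : ℝ → Fin N → ℝ)
    (hmeas : Measurable y')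
    (hFTC : ∀ t, y t = y 0 + ∫ s in (0:ℝ)..t, y' s)
    (hper : y 1 = y 0)
    (hint : IntervalIntegrable y' volume 0 1)
    (hLσ : IntegrableOn (fun t => (Real.sqrt (∑ i, (y' t i) ^ 2)) ^ σ) (Set.Ioc (0:ℝ) 1)) :
    IsProbabilityMeasure (Measure.map y' (volume.restrict (Set.Ioc (0:ℝ) 1))) ∧
    Integrable (fun v : Fin N → ℝ => (Real.sqrt (∑ i, (v i) ^ 2)) ^ σ)
      (Measure.map y' (volume.restrict (Set.Ioc (0:ℝ) 1))) ∧
    (∫ v, (Real.sqrt (∑ i, (v i) ^ 2)) ^ σ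
        ∂(Measure.map y' (volume.restrict (Set.Ioc (0:ℝ) 1))))
      = ∫ t in (0:ℝ)..1, (Real.sqrt (∑ i, (y' t i) ^ 2)) ^ σ ∧
    (∀ i, (∫ v, v i ∂(Measure.map y' (volume.restrict (Set.Ioc (0:ℝ) 1)))) = 0) ∧
    (∫ v, u v ∂(Measure.map y' (volume.restrict (Set.Ioc (0:ℝ) 1))))
      = ∫ t in (0:ℝ)..1, u (y' t) ∧
    (∫ v, ∑ i, m i * |v i + u v| ^ σ
        ∂(Measure.map y' (volume.restrict (Set.Ioc (0:ℝ) 1))))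
      = ∫ t in (0:ℝ)..1, ∑ i, m i * |y' t i + u (y' t)| ^ σ ∧
    ((0 < ∫ t in (0:ℝ)..1, ∑ i, m i * |y' t i + u (y' t)| ^ σ) →
      |∫ v, u v ∂(Measure.map y' (volume.restrict (Set.Ioc (0:ℝ) 1)))| ^ σ
          / (∫ v, ∑ i, m i * |v i + u v| ^ σ
              ∂(Measure.map y' (volume.restrict (Set.Ioc (0:ℝ) 1))))
        = |∫ t in (0:ℝ)..1, u (y' t)| ^ σ
          / (∫ t in (0:ℝ)..1, ∑ i, m i * |y' t i + u (y' t)| ^ σ)) ∧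
    ((∀ t, y' t ⟨0, hN⟩ = 0) →
      (∀ᵐ v ∂(Measure.map y' (volume.restrict (Set.Ioc (0:ℝ) 1))), v ⟨0, hN⟩ = 0)) := by
  have hum : Measurable u := measurable_argmin_sum_abs_rpow hσ.le (fun i => (hm i).le) hu huniq
  have hmap : ∀ f : (Fin N → ℝ) → ℝ, Measurable f →
      ∫ v, f v ∂(Measure.map y' (volume.restrict (Set.Ioc (0:ℝ) 1)))
        = ∫ t in (0:ℝ)..1, f (y' t) := fun f hf => by
    rw [integral_map hmeas.aemeasurable hf.aestronglyMeasurable, integral_of_le zero_le_one]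
  have hg : Measurable fun v : Fin N → ℝ => (Real.sqrt (∑ i, (v i) ^ 2)) ^ σ := by fun_prop
  have hD := hmap (fun v => ∑ i, m i * |v i + u v| ^ σ) (by fun_prop)
  refine ⟨?_, ?_, hmap _ hg, fun i => ?_, hmap u hum, hD, fun _ => ?_, fun h0 => ?_⟩
  · have : IsProbabilityMeasure (volume.restrict (Set.Ioc (0:ℝ) 1)) := ⟨by simp⟩
    exact Measure.isProbabilityMeasure_map hmeas.aemeasurable
  · exact (integrable_map_measure hg.aestronglyMeasurable hmeas.aemeasurable).2 hLσ
  · rw [hmap _ (measurable_pi_apply i)]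
    have hzero : ∫ s in (0:ℝ)..1, y' s = 0 := by
      have h1 := hFTC 1
      rwa [hper, left_eq_add] at h1
    have hcomm := (ContinuousLinearMap.proj (R := ℝ) (φ := fun _ : Fin N => ℝ) i)
      |>.intervalIntegral_comp_comm hint
    simpa [hzero] using hcomm
  · rw [hmap u hum, hD]
  · rw [ae_map_iff hmeas.aemeasurable
      (measurableSet_eq_fun (measurable_pi_apply _) measurable_const)]
    exact Filter.Eventually.of_forall h0
end

section
/- For every ν ∈ Λ̄_σ there exists a curve y ∈ Λ_σ such that the pushforward of Lebesgue measure on [0,1] under t ↦ ẏ(t) equals ν; in particular ∫₀¹ u(ẏ(t)) dt = ∫ u(v) ν(dv) and D(y) = D(ν), so that e_σ(y) = e_σ(ν) whenever D(ν) > 0. If moreover ν ∈ Λ̄⁰_σ, the curve y can be chosen with y_1 ≡ 0. -/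
open MeasureTheory intervalIntegral

/-- Every Borel probability measure on a standard Borel space is the law of a measurable function
under Lebesgue measure on `(0, 1]`. -/
lemma exists_measurable_map_volume_Ioc {Y : Type*} [MeasurableSpace Y] [StandardBorelSpace Y]
    [Nonempty Y] (μ : Measure Y) [IsProbabilityMeasure μ] :
    ∃ f : ℝ → Y, Measurable f ∧ Measure.map f (volume.restrict (Set.Ioc (0 : ℝ) 1)) = μ := by
  obtain ⟨f, hf, hmap⟩ := μ.exists_measurable_map_eq
  have hproj : Measurable (Set.projIcc (0 : ℝ) 1 zero_le_one) := continuous_projIcc.measurable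
  refine ⟨f ∘ Set.projIcc 0 1 zero_le_one, hf.comp hproj, ?_⟩
  have hcoe := unitInterval.measurePreserving_coe
  rw [restrict_Ioc_eq_restrict_Icc, ← hcoe.map_eq,
    Measure.map_map (hf.comp hproj) hcoe.measurable, ← hmap]
  congr 1
  ext t
  simp [Function.comp_def]

/-- The pointwise unique minimizer of a parametrized family of convex functions of a real variable
depends measurably on the parameter. -/
lemma measurable_of_unique_minimizer {Ω : Type*} [MeasurableSpace Ω] {L : ℝ → Ω → ℝ} {u : Ω → ℝ}
    (hconv : ∀ ω, ConvexOn ℝ Set.univ (fun ξ => L ξ ω)) (hmeas : ∀ ξ, Measurable (L ξ))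
    (hlt : ∀ ω ξ, ξ ≠ u ω → L (u ω) ω < L ξ ω) : Measurable u := by
  refine measurable_of_Iio fun c => ?_
  have key : u ⁻¹' Set.Iio c = ⋃ q : ℚ, ⋃ _ : (q : ℝ) < c, {ω | L q ω < L c ω} := by
    ext ω
    simp only [Set.mem_preimage, Set.mem_Iio, Set.mem_iUnion, Set.mem_ofPred_eq, exists_prop]
    constructor
    · intro h
      obtain ⟨q, huq, hqc⟩ := exists_rat_btwn h
      refine ⟨q, hqc, ?_⟩
      exact (hconv ω).lt_right_of_left_lt (Set.mem_univ (u ω)) (Set.mem_univ c)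
        (by rw [openSegment_eq_Ioo h]; exact ⟨huq, hqc⟩)
        (hlt ω q huq.ne')
    · rintro ⟨q, hqc, hq⟩
      by_contra! hcu
      rcases hcu.eq_or_lt with rfl | hcu
      · exact (hlt ω q hqc.ne).not_gt hq
      · have := (hconv ω).lt_right_of_left_lt (Set.mem_univ (q : ℝ)) (Set.mem_univ (u ω))
          (by rw [openSegment_eq_Ioo (hqc.trans hcu)]; exact ⟨hqc, hcu⟩) hq
        exact (hlt ω c hcu.ne).not_gt this
  rw [key]
  exact .iUnion fun q => .iUnion fun _ => measurableSet_lt (hmeas _) (hmeas _)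

lemma convexOn_abs_add_rpow {σ : ℝ} (hσ : 1 ≤ σ) (a : ℝ) :
    ConvexOn ℝ Set.univ (fun ξ : ℝ => |a + ξ| ^ σ) := by
  have habs : ConvexOn ℝ Set.univ (fun ξ : ℝ => |a + ξ|) := by
    simpa [Function.comp_def] using (convexOn_univ_norm (E := ℝ)).translate_right a
  refine ⟨convex_univ, fun x _ y _ s t hs ht hst => ?_⟩
  calc |a + (s • x + t • y)| ^ σ ≤ (s • |a + x| + t • |a + y|) ^ σ :=
        Real.rpow_le_rpow (abs_nonneg _) (habs.2 trivial trivial hs ht hst) (by linarith)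
    _ ≤ _ := (convexOn_rpow hσ).2 (abs_nonneg (a + x)) (abs_nonneg (a + y)) hs ht hst

/-- The sup norm is dominated by the Euclidean norm. -/
lemma norm_le_sqrt_sum_sq {ι : Type*} [Fintype ι] (v : ι → ℝ) :
    ‖v‖ ≤ Real.sqrt (∑ i, (v i) ^ 2) := by
  refine (pi_norm_le_iff_of_nonneg (Real.sqrt_nonneg _)).2 fun i => ?_
  rw [Real.norm_eq_abs]
  exact Real.abs_le_sqrt
    (Finset.single_le_sum (f := fun i => (v i) ^ 2) (fun j _ => sq_nonneg _) (Finset.mem_univ i))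

/-- A finite moment of order at least one gives a finite first moment. -/
lemma integrable_id_of_integrable_rpow {ι : Type*} [Fintype ι] {σ : ℝ} (hσ : 1 ≤ σ)
    {ν : Measure (ι → ℝ)} [IsFiniteMeasure ν]
    (h : Integrable (fun v : ι → ℝ => (Real.sqrt (∑ i, (v i) ^ 2)) ^ σ) ν) :
    Integrable (fun v : ι → ℝ => v) ν := by
  refine ((integrable_const (1 : ℝ)).add h).mono' measurable_id.aestronglyMeasurable
    (.of_forall fun v => (norm_le_sqrt_sum_sq v).trans ?_)
  simp only [Pi.add_apply]
  set r := Real.sqrt (∑ i, (v i) ^ 2)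
  have hr : 0 ≤ r := Real.sqrt_nonneg _
  rcases le_total r 1 with h1 | h1
  · linarith [Real.rpow_nonneg hr σ]
  · linarith [Real.self_le_rpow_of_one_le h1 hσ]

/-- A velocity with centred law `ν` integrates to a closed curve. -/
lemma exists_closed_curve_of_map_eq {N : ℕ} {σ : ℝ} (hσ : 1 ≤ σ) (m : Fin N → ℝ)
    {u : (Fin N → ℝ) → ℝ} (humeas : Measurable u)
    {ν : Measure (Fin N → ℝ)} [IsFiniteMeasure ν]
    (hσmom : Integrable (fun v : Fin N → ℝ => (Real.sqrt (∑ i, (v i) ^ 2)) ^ σ) ν)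
    (hmom : ∀ i, (∫ v, v i ∂ν) = 0)
    {y' : ℝ → Fin N → ℝ} (hy' : Measurable y')
    (hmap : Measure.map y' (volume.restrict (Set.Ioc (0:ℝ) 1)) = ν) :
    ∃ y : ℝ → Fin N → ℝ,
      (∀ t, y t = y 0 + ∫ s in (0:ℝ)..t, y' s) ∧
      y 1 = y 0 ∧
      IntervalIntegrable y' volume 0 1 ∧
      IntegrableOn (fun t => (Real.sqrt (∑ i, (y' t i) ^ 2)) ^ σ) (Set.Ioc (0:ℝ) 1) ∧
      Measure.map y' (volume.restrict (Set.Ioc (0:ℝ) 1)) = ν ∧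
      (∫ t in (0:ℝ)..1, u (y' t)) = (∫ v, u v ∂ν) ∧
      (∫ t in (0:ℝ)..1, ∑ i, m i * |y' t i + u (y' t)| ^ σ)
        = (∫ v, ∑ i, m i * |v i + u v| ^ σ ∂ν) := by
  have hid : Integrable (fun v : Fin N → ℝ => v) ν := integrable_id_of_integrable_rpow hσ hσmom
  have hmean : (∫ v, v ∂ν) = 0 := by
    ext i
    rw [eval_integral fun i => hid.eval i]
    exact hmom i
  have hpush : ∀ {E : Type} [NormedAddCommGroup E] [NormedSpace ℝ E] {g : (Fin N → ℝ) → E},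
      AEStronglyMeasurable g ν → (∫ t in (0:ℝ)..1, g (y' t)) = ∫ v, g v ∂ν := by
    intro E _ _ g hg
    rw [intervalIntegral.integral_of_le zero_le_one, ← hmap,
      integral_map hy'.aemeasurable (hmap.symm ▸ hg)]
  have hpull : ∀ {E : Type} [NormedAddCommGroup E] {g : (Fin N → ℝ) → E},
      Integrable g ν → IntegrableOn (fun t => g (y' t)) (Set.Ioc (0:ℝ) 1) := by
    intro E _ g hg
    rw [← hmap] at hg
    exact hg.comp_measurable hy'
  refine ⟨fun t => ∫ s in (0:ℝ)..t, y' s, fun t => by simp, ?_,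
    (intervalIntegrable_iff_integrableOn_Ioc_of_le zero_le_one).2 (hpull hid), hpull hσmom, hmap,
    hpush humeas.aestronglyMeasurable, hpush (g := fun v => ∑ i, m i * |v i + u v| ^ σ) ?_⟩
  · simpa [hmean] using hpush hid.aestronglyMeasurable
  · exact Measurable.aestronglyMeasurable (by fun_prop)

/-- (From generalized Young measures back to curves.) For every
`ν ∈ Λ̄_σ` there is a curve `y ∈ Λ_σ` whose velocity pushes Lebesgue measure on `[0,1]`
forward to `ν`; in particular `∫₀¹ u(ẏ) dt = ∫ u dν` and `D(y) = D(ν)`, so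
`e_σ(y) = e_σ(ν)` whenever `D(ν) > 0`. If moreover `ν ∈ Λ̄⁰_σ` (concentrated on
`{v : v₁ = 0}`), then `y` can be chosen with `ẏ₁ ≡ 0`. -/
theorem curve_of_young_measure
    (N : ℕ) (hN : 0 < N) (σ : ℝ) (hσ : 1 < σ)
    (m : Fin N → ℝ) (hm : ∀ i, 0 < m i) (hsum : ∑ i, m i = 1)
    (u : (Fin N → ℝ) → ℝ)
    (hu : ∀ v ξ, ∑ i, m i * |v i + u v| ^ σ ≤ ∑ i, m i * |v i + ξ| ^ σ)
    (huniq : ∀ v ξ, (∀ ζ, ∑ i, m i * |v i + ξ| ^ σ ≤ ∑ i, m i * |v i + ζ| ^ σ) → ξ = u v)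
    (ν : Measure (Fin N → ℝ)) (hprob : IsProbabilityMeasure ν)
    (hσmom : Integrable (fun v : Fin N → ℝ => (Real.sqrt (∑ i, (v i) ^ 2)) ^ σ) ν)
    (hmom : ∀ i, (∫ v, v i ∂ν) = 0) :
    (∃ y y' : ℝ → Fin N → ℝ,
      Measurable y' ∧
      (∀ t, y t = y 0 + ∫ s in (0:ℝ)..t, y' s) ∧
      y 1 = y 0 ∧
      IntervalIntegrable y' volume 0 1 ∧
      IntegrableOn (fun t => (Real.sqrt (∑ i, (y' t i) ^ 2)) ^ σ) (Set.Ioc (0:ℝ) 1) ∧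
      Measure.map y' (volume.restrict (Set.Ioc (0:ℝ) 1)) = ν ∧
      (∫ t in (0:ℝ)..1, u (y' t)) = (∫ v, u v ∂ν) ∧
      (∫ t in (0:ℝ)..1, ∑ i, m i * |y' t i + u (y' t)| ^ σ)
        = (∫ v, ∑ i, m i * |v i + u v| ^ σ ∂ν)) ∧
    ((∀ᵐ v ∂ν, v ⟨0, hN⟩ = 0) →
      ∃ y y' : ℝ → Fin N → ℝ,
        Measurable y' ∧
        (∀ t, y' t ⟨0, hN⟩ = 0) ∧
        (∀ t, y t = y 0 + ∫ s in (0:ℝ)..t, y' s) ∧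
        y 1 = y 0 ∧
        IntervalIntegrable y' volume 0 1 ∧
        IntegrableOn (fun t => (Real.sqrt (∑ i, (y' t i) ^ 2)) ^ σ) (Set.Ioc (0:ℝ) 1) ∧
        Measure.map y' (volume.restrict (Set.Ioc (0:ℝ) 1)) = ν ∧
        (∫ t in (0:ℝ)..1, u (y' t)) = (∫ v, u v ∂ν) ∧
        (∫ t in (0:ℝ)..1, ∑ i, m i * |y' t i + u (y' t)| ^ σ)
          = (∫ v, ∑ i, m i * |v i + u v| ^ σ ∂ν)) := by
  have humeas : Measurable u := by
    refine measurable_of_unique_minimizer (L := fun ξ v => ∑ i, m i * |v i + ξ| ^ σ)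
      (fun v => ?_) (fun ξ => by fun_prop) (fun v ξ hne => ?_)
    · refine ⟨convex_univ, fun x _ y _ s t hs ht hst => ?_⟩
      simp only [smul_eq_mul, Finset.mul_sum, ← Finset.sum_add_distrib]
      refine Finset.sum_le_sum fun i _ => ?_
      have := (convexOn_abs_add_rpow hσ.le (v i)).2 (Set.mem_univ x) (Set.mem_univ y) hs ht hst
      simp only [smul_eq_mul] at this
      nlinarith [mul_le_mul_of_nonneg_left this (hm i).le]
    · refine lt_of_not_ge fun hle => hne (huniq v ξ fun ζ => hle.trans (hu v ζ))
  obtain ⟨f, hf, hmap⟩ := exists_measurable_map_volume_Ioc ν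
  constructor
  · obtain ⟨y, hy⟩ := exists_closed_curve_of_map_eq hσ.le m humeas hσmom hmom hf hmap
    exact ⟨y, f, hf, hy⟩
  · intro h0
    have hupd : Measurable fun v : Fin N → ℝ => Function.update v ⟨0, hN⟩ (0 : ℝ) :=
      measurable_update_left
    have hmap0 : Measure.map (fun t => Function.update (f t) ⟨0, hN⟩ (0 : ℝ))
        (volume.restrict (Set.Ioc (0:ℝ) 1)) = ν := by
      have hid : (fun v : Fin N → ℝ => Function.update v ⟨0, hN⟩ (0 : ℝ)) =ᵐ[ν] id := by
        filter_upwards [h0] with v hv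
        rw [← hv, Function.update_eq_self, id]
      change Measure.map ((fun v : Fin N → ℝ => Function.update v ⟨0, hN⟩ (0 : ℝ)) ∘ f) _ = ν
      rw [← Measure.map_map hupd hf, hmap, Measure.map_congr hid, Measure.map_id]
    obtain ⟨y, hy⟩ := exists_closed_curve_of_map_eq hσ.le m humeas hσmom hmom
      (hupd.comp hf) hmap0
    exact ⟨y, _, hupd.comp hf, fun t => by simp, hy⟩
end

section
/- Suppose the homogeneous mechanical system is mobilized, i.e. there exists ŷ ∈ Λ_σ with ∫₀¹ u(ẏ̂(t)) dt ≠ 0. Then the supremum ē_σ := sup { e_σ(y) : y ∈ Λ_σ, D(y) > 0 } is attained: there exists ȳ ∈ Λ_σ with D(ȳ) > 0 and e_σ(ȳ) = ē_σ. Moreover ē_σ < 1. -/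
open MeasureTheory intervalIntegral

/-- Membership in `Λ_σ` together with the fundamental theorem of calculus description
of absolute continuity: `y(t) = y(0) + ∫₀ᵗ ẏ`, `y(1) = y(0)`, `ẏ ∈ L¹ ∩ L^σ(0,1)`. -/
def MemLam (N : ℕ) (σ : ℝ) (y y' : ℝ → Fin N → ℝ) : Prop :=
  (∀ t, y t = y 0 + ∫ s in (0:ℝ)..t, y' s) ∧
  y 1 = y 0 ∧
  IntervalIntegrable y' MeasureTheory.volume 0 1 ∧
  MeasureTheory.IntegrableOn (fun t => (Real.sqrt (∑ i, (y' t i) ^ 2)) ^ σ)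
    (Set.Ioc (0:ℝ) 1)

/-- Dissipation of a curve: `D(y) = ∫₀¹ ∑ᵢ mᵢ |ẏᵢ + u(ẏ)|^σ dt`. -/
noncomputable def curveDissip (N : ℕ) (m : Fin N → ℝ) (σ : ℝ) (u : (Fin N → ℝ) → ℝ)
    (y' : ℝ → Fin N → ℝ) : ℝ :=
  ∫ t in (0:ℝ)..1, ∑ i, m i * |y' t i + u (y' t)| ^ σ

/-- Efficiency of a curve: `e_σ(y) = |∫₀¹ u(ẏ) dt|^σ / D(y)`. -/
noncomputable def curveEffic (N : ℕ) (m : Fin N → ℝ) (σ : ℝ) (u : (Fin N → ℝ) → ℝ)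
    (y' : ℝ → Fin N → ℝ) : ℝ :=
  |∫ t in (0:ℝ)..1, u (y' t)| ^ σ / curveDissip N m σ u y'

theorem isCompact_convexHull_of_isCompact {E : Type*} [NormedAddCommGroup E] [NormedSpace ℝ E]
    [FiniteDimensional ℝ E] {s : Set E} (hs : IsCompact s) : IsCompact (convexHull ℝ s) := by
  classical
  let d := Module.finrank ℝ E + 1
  let f : (Fin d → ℝ) × (Fin d → E) → E := fun p => ∑ i, p.1 i • p.2 i
  have hf : Continuous f := by fun_prop
  have hK : IsCompact (stdSimplex ℝ (Fin d) ×ˢ (Set.univ.pi fun _ : Fin d => s)) :=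
    (isCompact_stdSimplex ℝ (Fin d)).prod (isCompact_univ_pi fun _ => hs)
  convert hK.image hf
  apply Set.Subset.antisymm
  · intro x hx
    obtain ⟨ι, _, z, w, hz, hind, hw, hw1, hx⟩ := eq_pos_convex_span_of_mem_convexHull hx
    have hcard : Fintype.card ι ≤ d := hind.card_le_finrank_succ.trans
      (Nat.succ_le_succ (Submodule.finrank_le _))
    obtain ⟨e⟩ : Nonempty (ι ↪ Fin d) := by
      apply Function.Embedding.nonempty_of_card_le
      simpa using hcard
    obtain ⟨i₀⟩ : Nonempty ι := by
      by_contra h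
      rw [not_nonempty_iff] at h
      simp at hw1
    refine ⟨(Function.extend e w 0, Function.extend e z fun _ => z i₀), ⟨⟨?_, ?_⟩, ?_⟩, ?_⟩
    · intro j
      by_cases hj : ∃ i, e i = j
      · obtain ⟨i, rfl⟩ := hj
        simpa [e.injective.extend_apply] using (hw i).le
      · simp [Function.extend_apply' _ _ _ hj]
    · rw [← hw1]
      symm
      refine Fintype.sum_of_injective e e.injective _ _ ?_ ?_
      · intro j hj
        exact Function.extend_apply' _ _ _ (by simpa using hj)
      · intro i
        simp [e.injective.extend_apply]
    · intro j _
      by_cases hj : ∃ i, e i = j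
      · obtain ⟨i, rfl⟩ := hj
        simpa [e.injective.extend_apply] using hz ⟨i, rfl⟩
      · simpa [Function.extend_apply' _ _ _ hj] using hz ⟨i₀, rfl⟩
    · rw [← hx]
      symm
      refine Fintype.sum_of_injective e e.injective _ _ ?_ ?_
      · intro j hj
        simp [Function.extend_apply' _ _ _ (show ¬∃ i, e i = j by simpa using hj)]
      · intro i
        simp [e.injective.extend_apply]
  · rintro _ ⟨⟨w, z⟩, ⟨⟨hw, hw1⟩, hz⟩, rfl⟩
    exact (convex_convexHull ℝ s).sum_mem (fun i _ => hw i) hw1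
      fun i _ => subset_convexHull ℝ s (hz i trivial)

/-- Averages over the unit interval of measurable `s`-valued functions exhaust `convexHull ℝ s`. -/
theorem exists_measurable_integral_eq_of_mem_convexHull {E : Type*} [NormedAddCommGroup E]
    [NormedSpace ℝ E] [FiniteDimensional ℝ E] [MeasurableSpace E] [BorelSpace E] {s : Set E}
    (hs : Bornology.IsBounded s) {x : E} (hx : x ∈ convexHull ℝ s) :
    ∃ w : ℝ → E, Measurable w ∧ (∀ t, w t ∈ s) ∧ ∫ t in (0 : ℝ)..1, w t = x := by
  obtain ⟨C, hC⟩ := hs.exists_norm_le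
  have hint : ∀ w : ℝ → E, Measurable w → (∀ t, w t ∈ s) → ∀ a b : ℝ,
      IntervalIntegrable w volume a b := fun w hw hws a b =>
    (intervalIntegrable_const (c := C)).mono_fun hw.aestronglyMeasurable
      (.of_forall fun t => (hC _ (hws t)).trans (le_abs_self C))
  refine convexHull_min (t := {x | ∃ w : ℝ → E, Measurable w ∧ (∀ t, w t ∈ s) ∧
    ∫ t in (0 : ℝ)..1, w t = x}) ?_ ?_ hx
  · intro y hy
    exact ⟨fun _ => y, measurable_const, fun _ => hy, by simp⟩
  · rw [convex_iff_forall_pos]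
    rintro _ ⟨w, hw, hws, rfl⟩ _ ⟨z, hz, hzs, rfl⟩ a b ha hb hab
    let q : ℝ → E := fun t => if t ≤ a then w (t / a) else z ((t - a) / b)
    have hq : Measurable q :=
      Measurable.ite measurableSet_Iic (hw.comp (by fun_prop)) (hz.comp (by fun_prop))
    have hqs : ∀ t, q t ∈ s := fun t => by
      dsimp only [q]
      split_ifs
      exacts [hws _, hzs _]
    refine ⟨q, hq, hqs, ?_⟩
    rw [← integral_add_adjacent_intervals (hint q hq hqs 0 a) (hint q hq hqs a 1)]
    congr 1
    · have : ∫ t in (0 : ℝ)..a, q t = ∫ t in (0 : ℝ)..a, w (t / a) := by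
        refine integral_congr_uIoo fun t ht => ?_
        rw [Set.uIoo_of_le ha.le] at ht
        simp [q, ht.2.le]
      rw [this, integral_comp_div _ ha.ne']
      simp [ha.ne']
    · have : ∫ t in a..1, q t = ∫ t in a..1, z (t / b - a / b) := by
        refine integral_congr_uIoo fun t ht => ?_
        rw [Set.uIoo_of_le (by linarith)] at ht
        simp [q, ht.1, sub_div]
      rw [this, integral_comp_div_sub _ hb.ne']
      have : 1 / b - a / b = 1 := by
        rw [← sub_div, div_eq_one_iff_eq hb.ne']
        linarith
      rw [this, sub_self]

/-- The weighted sum of powers `∑ᵢ mᵢ |vᵢ|^σ`. -/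
noncomputable def weightedPowSum {ι : Type*} [Fintype ι] (m : ι → ℝ) (σ : ℝ) (v : ι → ℝ) : ℝ :=
  ∑ i, m i * |v i| ^ σ

/-- The unit sphere of `weightedPowSum` inside the cone of vectors which are optimal among their
translates by constants. -/
def optimalSphere {ι : Type*} [Fintype ι] (m : ι → ℝ) (σ : ℝ) : Set (ι → ℝ) :=
  {v | weightedPowSum m σ v = 1 ∧
    ∀ ξ : ℝ, weightedPowSum m σ v ≤ weightedPowSum m σ fun i => v i + ξ}

section WeightedPowSum

variable {ι : Type*} [Fintype ι] {m : ι → ℝ} {σ : ℝ}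

theorem continuous_weightedPowSum (hσ : 0 ≤ σ) : Continuous (weightedPowSum m σ) := by
  unfold weightedPowSum
  exact continuous_finsetSum _ fun i _ =>
    continuous_const.mul ((continuous_apply i).abs.rpow_const fun _ => Or.inr hσ)

theorem weightedPowSum_nonneg (hm : ∀ i, 0 < m i) (v : ι → ℝ) : 0 ≤ weightedPowSum m σ v :=
  Finset.sum_nonneg fun i _ => mul_nonneg (hm i).le (Real.rpow_nonneg (abs_nonneg _) _)

theorem weightedPowSum_const (hsum : ∑ i, m i = 1) (c : ℝ) :
    weightedPowSum m σ (fun _ => c) = |c| ^ σ := by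
  simp [weightedPowSum, ← Finset.sum_mul, hsum]

theorem weightedPowSum_mul (c : ℝ) (v : ι → ℝ) :
    weightedPowSum m σ (fun i => c * v i) = |c| ^ σ * weightedPowSum m σ v := by
  simp only [weightedPowSum, Finset.mul_sum, abs_mul]
  refine Finset.sum_congr rfl fun i _ => ?_
  rw [Real.mul_rpow (abs_nonneg _) (abs_nonneg _)]
  ring

theorem abs_apply_le_mul_weightedPowSum_rpow (hσ : 0 < σ) (hm : ∀ i, 0 < m i) (v : ι → ℝ)
    (i : ι) : |v i| ≤ (m i)⁻¹ ^ σ⁻¹ * weightedPowSum m σ v ^ σ⁻¹ := by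
  rw [← Real.mul_rpow (inv_nonneg.2 (hm i).le) (weightedPowSum_nonneg hm v),
    Real.le_rpow_inv_iff_of_pos (abs_nonneg _)
      (mul_nonneg (inv_nonneg.2 (hm i).le) (weightedPowSum_nonneg hm v)) hσ,
    le_inv_mul_iff₀ (hm i)]
  exact Finset.single_le_sum (f := fun i => m i * |v i| ^ σ)
    (fun j _ => mul_nonneg (hm j).le (Real.rpow_nonneg (abs_nonneg _) _)) (Finset.mem_univ i)

theorem weightedPowSum_rpow_le_norm (hσ : 0 < σ) (hm : ∀ i, 0 < m i) (hsum : ∑ i, m i = 1)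
    (v : ι → ℝ) : weightedPowSum m σ v ^ σ⁻¹ ≤ ‖v‖ := by
  rw [Real.rpow_inv_le_iff_of_pos (weightedPowSum_nonneg hm v) (norm_nonneg v) hσ]
  calc weightedPowSum m σ v ≤ ∑ i, m i * ‖v‖ ^ σ := by
        refine Finset.sum_le_sum fun i _ => mul_le_mul_of_nonneg_left ?_ (hm i).le
        exact Real.rpow_le_rpow (abs_nonneg _) (norm_le_pi_norm v i) hσ.le
    _ = ‖v‖ ^ σ := by rw [← Finset.sum_mul, hsum, one_mul]

theorem isCompact_optimalSphere (hσ : 0 < σ) (hm : ∀ i, 0 < m i) :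
    IsCompact (optimalSphere m σ) := by
  have hc := continuous_weightedPowSum (m := m) hσ.le
  refine (isCompact_univ_pi fun i => isCompact_Icc (a := -(m i)⁻¹ ^ σ⁻¹)
    (b := (m i)⁻¹ ^ σ⁻¹)).of_isClosed_subset ?_ ?_
  · simp only [optimalSphere, Set.ofPred_and, Set.ofPred_forall]
    exact (isClosed_eq hc continuous_const).inter
      (isClosed_iInter fun ξ => isClosed_le hc (hc.comp (by fun_prop)))
  · intro v hv i _
    have := abs_apply_le_mul_weightedPowSum_rpow hσ hm v i
    rw [hv.1, Real.one_rpow, mul_one] at this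
    exact abs_le.1 this

theorem inv_smul_mem_optimalSphere {v : ι → ℝ}
    (hv : ∀ ξ : ℝ, weightedPowSum m σ v ≤ weightedPowSum m σ fun i => v i + ξ) {c : ℝ}
    (hc : c ≠ 0) (hcv : |c| ^ σ = weightedPowSum m σ v) : c⁻¹ • v ∈ optimalSphere m σ := by
  have h1 : weightedPowSum m σ (c⁻¹ • v) = 1 := by
    have := weightedPowSum_mul (m := m) (σ := σ) c⁻¹ v
    rw [← hcv, abs_inv, Real.inv_rpow (abs_nonneg _),
      inv_mul_cancel₀ (Real.rpow_pos_of_pos (abs_pos.2 hc) σ).ne'] at this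
    exact this
  refine ⟨h1, fun ξ => ?_⟩
  have h2 := hv (c * ξ)
  have h3 := weightedPowSum_mul (m := m) (σ := σ) c fun i => (c⁻¹ • v) i + ξ
  have h4 : (fun i => c * ((c⁻¹ • v) i + ξ)) = fun i => v i + c * ξ := by
    ext i
    simp only [Pi.smul_apply, smul_eq_mul]
    field_simp
  rw [h4] at h3
  rw [h3, ← hcv, le_mul_iff_one_le_right (Real.rpow_pos_of_pos (abs_pos.2 hc) σ)] at h2
  rwa [h1]

theorem neg_optimalSphere : -optimalSphere m σ = optimalSphere m σ := by
  have key : ∀ v ∈ optimalSphere m σ, -v ∈ optimalSphere m σ := fun v hv => by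
    simpa using inv_smul_mem_optimalSphere hv.2 (c := -1) (by simp) (by simp [hv.1])
  ext v
  exact ⟨fun hv => by simpa using key _ hv, fun hv => key _ hv⟩

theorem sum_mul_lt_one_of_mem_optimalSphere (hσ : 1 < σ) (hm : ∀ i, 0 < m i)
    (hsum : ∑ i, m i = 1) {v : ι → ℝ} (hv : v ∈ optimalSphere m σ) : ∑ i, m i * v i < 1 := by
  have hle : ∀ x : ℝ, 1 + σ * (x - 1) ≤ |x| ^ σ := fun x => by
    have := one_add_mul_self_le_rpow_one_add (s := |x| - 1) (by linarith [abs_nonneg x]) hσ.le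
    rw [add_sub_cancel] at this
    nlinarith [le_abs_self x]
  have hlt : ∀ x : ℝ, x ≠ 1 → 1 + σ * (x - 1) < |x| ^ σ := fun x hx => by
    rcases le_or_gt 0 x with h0 | h0
    · rw [abs_of_nonneg h0]
      have := one_add_mul_self_lt_rpow_one_add (s := x - 1) (by linarith) (sub_ne_zero.2 hx) hσ
      rwa [add_sub_cancel] at this
    · have := hle |x|
      rw [abs_abs, abs_of_neg h0] at this
      rw [abs_of_neg h0]
      nlinarith
  obtain ⟨j, hj⟩ : ∃ j, v j ≠ 1 := by
    by_contra! h
    have hv2 := hv.2 (-1)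
    obtain rfl : v = fun _ => 1 := funext h
    rw [hv.1, weightedPowSum_const hsum] at hv2
    norm_num [Real.zero_rpow (by linarith : σ ≠ 0)] at hv2
  have h : ∑ i, m i * (1 + σ * (v i - 1)) < weightedPowSum m σ v :=
    Finset.sum_lt_sum (fun i _ => mul_le_mul_of_nonneg_left (hle _) (hm i).le)
      ⟨j, Finset.mem_univ j, mul_lt_mul_of_pos_left (hlt _ hj) (hm j)⟩
  have h2 : ∑ i, m i * (1 + σ * (v i - 1)) = 1 + σ * (∑ i, m i * v i - 1) := by
    calc ∑ i, m i * (1 + σ * (v i - 1)) = ∑ i, (m i * (1 - σ) + σ * (m i * v i)) :=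
          Finset.sum_congr rfl fun i _ => by ring
      _ = _ := by rw [Finset.sum_add_distrib, ← Finset.sum_mul, ← Finset.mul_sum, hsum]; ring
  rw [h2, hv.1] at h
  nlinarith

theorem lt_one_of_const_mem_convexHull (hσ : 1 < σ) (hm : ∀ i, 0 < m i)
    (hsum : ∑ i, m i = 1) {c : ℝ} (hc : (fun _ => c) ∈ convexHull ℝ (optimalSphere m σ)) :
    c < 1 := by
  have hconv : Convex ℝ {v : ι → ℝ | ∑ i, m i * v i < 1} :=
    convex_halfSpace_lt ⟨fun v w => by simp [mul_add, Finset.sum_add_distrib],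
      fun a v => by
        simp only [Pi.smul_apply, smul_eq_mul, Finset.mul_sum]
        exact Finset.sum_congr rfl fun i _ => by ring⟩ 1
  have h : ∑ i, m i * c < 1 :=
    convexHull_min (fun v hv => sum_mul_lt_one_of_mem_optimalSphere hσ hm hsum hv) hconv hc
  rwa [← Finset.sum_mul, hsum, one_mul] at h

variable {Ω : Type*} [MeasurableSpace Ω] {μ : Measure Ω} {w : Ω → ι → ℝ}

theorem integrable_weightedPowSum_rpow (hσ : 0 < σ) (hm : ∀ i, 0 < m i) (hsum : ∑ i, m i = 1)
    (hw : Integrable w μ) : Integrable (fun t => weightedPowSum m σ (w t) ^ σ⁻¹) μ := by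
  refine hw.norm.mono' ?_ (.of_forall fun t => ?_)
  · exact ((continuous_weightedPowSum hσ.le).rpow_const fun _ =>
      Or.inr (inv_nonneg.2 hσ.le)).comp_aestronglyMeasurable hw.aestronglyMeasurable
  · rw [Real.norm_of_nonneg (Real.rpow_nonneg (weightedPowSum_nonneg hm _) _)]
    exact weightedPowSum_rpow_le_norm hσ hm hsum _

theorem integral_weightedPowSum_rpow_rpow_le [IsProbabilityMeasure μ] (hσ : 1 < σ)
    (hm : ∀ i, 0 < m i) (hsum : ∑ i, m i = 1) (hw : Integrable w μ)
    (hint : Integrable (fun t => weightedPowSum m σ (w t)) μ) :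
    (∫ t, weightedPowSum m σ (w t) ^ σ⁻¹ ∂μ) ^ σ ≤ ∫ t, weightedPowSum m σ (w t) ∂μ := by
  have hσ0 : 0 < σ := by linarith
  have heq : ∀ t, (weightedPowSum m σ (w t) ^ σ⁻¹) ^ σ = weightedPowSum m σ (w t) := fun t =>
    Real.rpow_inv_rpow (weightedPowSum_nonneg hm _) hσ0.ne'
  have := (convexOn_rpow hσ.le).map_integral_le (μ := μ)
    (f := fun t => weightedPowSum m σ (w t) ^ σ⁻¹)
    (Real.continuous_rpow_const hσ0.le).continuousOn isClosed_Ici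
    (.of_forall fun t => Real.rpow_nonneg (weightedPowSum_nonneg hm _) _)
    (integrable_weightedPowSum_rpow hσ0 hm hsum hw)
    (by simpa only [Function.comp_def, heq] using hint)
  simpa only [heq] using this

theorem const_div_mem_convexHull_optimalSphere [Nonempty ι] (hσ : 0 < σ) (hm : ∀ i, 0 < m i)
    (hsum : ∑ i, m i = 1) (hw : Integrable w μ)
    (hopt : ∀ t, ∀ ξ : ℝ, weightedPowSum m σ (w t) ≤ weightedPowSum m σ fun i => w t i + ξ)
    {c : ℝ} (hc : c ≠ 0) (hwc : ∫ t, w t ∂μ = fun _ => c) :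
    0 < ∫ t, weightedPowSum m σ (w t) ^ σ⁻¹ ∂μ ∧
      (fun _ => c / ∫ t, weightedPowSum m σ (w t) ^ σ⁻¹ ∂μ) ∈
        convexHull ℝ (optimalSphere m σ) := by
  have hr := integrable_weightedPowSum_rpow hσ hm hsum hw
  have hr0 : ∀ t, 0 ≤ weightedPowSum m σ (w t) ^ σ⁻¹ := fun t =>
    Real.rpow_nonneg (weightedPowSum_nonneg hm _) _
  set R := ∫ t, weightedPowSum m σ (w t) ^ σ⁻¹ ∂μ with hR
  have hRpos : 0 < R := by
    obtain ⟨i⟩ := ‹Nonempty ι›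
    have h1 : ∫ t, w t i ∂μ = c := by
      rw [← eval_integral fun i => hw.eval i, hwc]
    have h2 : |c| ≤ (m i)⁻¹ ^ σ⁻¹ * R := by
      rw [← h1, hR, ← Real.norm_eq_abs, ← MeasureTheory.integral_const_mul]
      exact norm_integral_le_of_norm_le (hr.const_mul _)
        (.of_forall fun t => abs_apply_le_mul_weightedPowSum_rpow hσ hm (w t) i)
    exact pos_of_mul_pos_right ((abs_pos.2 hc).trans_le h2)
      (Real.rpow_nonneg (inv_nonneg.2 (hm i).le) _)
  refine ⟨hRpos, ?_⟩
  by_contra hnot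
  obtain ⟨f, b, hfb, hbf⟩ := geometric_hahn_banach_closed_point (convex_convexHull ℝ _)
    (isCompact_convexHull_of_isCompact (isCompact_optimalSphere hσ hm)).isClosed hnot
  have hle : ∀ t, f (w t) ≤ b * weightedPowSum m σ (w t) ^ σ⁻¹ := fun t => by
    rcases (hr0 t).eq_or_lt with h0 | h0
    · have : w t = 0 := by
        ext i
        have := abs_apply_le_mul_weightedPowSum_rpow hσ hm (w t) i
        rw [← h0, mul_zero] at this
        exact abs_nonpos_iff.1 this
      rw [← h0, this, map_zero, mul_zero]
    · have := hfb _ (subset_convexHull ℝ _ (inv_smul_mem_optimalSphere (hopt t) h0.ne' (by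
        rw [abs_of_pos h0, Real.rpow_inv_rpow (weightedPowSum_nonneg hm _) hσ.ne'])))
      rw [map_smul, smul_eq_mul, inv_mul_lt_iff₀ h0] at this
      linarith
  have h1 : f (fun _ => c) ≤ b * R := by
    rw [← hwc, ← f.integral_comp_comm hw, hR, ← MeasureTheory.integral_const_mul]
    exact integral_mono (f.integrable_comp hw) (hr.const_mul b) hle
  have h2 : (fun _ : ι => c / R) = R⁻¹ • fun _ : ι => c := by
    ext i
    simp [div_eq_inv_mul]
  rw [h2, map_smul, smul_eq_mul, lt_inv_mul_iff₀ hRpos] at hbf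
  linarith

end WeightedPowSum

/-- **Main Theorem.** If the homogeneous mechanical system is mobilized,
then the efficiency attains its supremum `ē_σ` on `Λ_σ` at some curve `ȳ`, and
`ē_σ < 1`. -/
theorem max_efficiency_attained_and_lt_one
    (N : ℕ) (hN : 1 ≤ N) (σ : ℝ) (hσ : 1 < σ)
    (m : Fin N → ℝ) (hm : ∀ i, 0 < m i) (hsum : ∑ i, m i = 1)
    (u : (Fin N → ℝ) → ℝ)
    (hu : ∀ v ξ, ∑ i, m i * |v i + u v| ^ σ ≤ ∑ i, m i * |v i + ξ| ^ σ)
    (huniq : ∀ v ξ, (∀ ζ, ∑ i, m i * |v i + ξ| ^ σ ≤ ∑ i, m i * |v i + ζ| ^ σ) → ξ = u v)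
    (hmob : ∃ y y' : ℝ → Fin N → ℝ, MemLam N σ y y' ∧
      (∫ t in (0:ℝ)..1, u (y' t)) ≠ 0) :
    ∃ ybar ybar' : ℝ → Fin N → ℝ, MemLam N σ ybar ybar' ∧
      0 < curveDissip N m σ u ybar' ∧
      (∀ y y' : ℝ → Fin N → ℝ, MemLam N σ y y' → 0 < curveDissip N m σ u y' →
        curveEffic N m σ u y' ≤ curveEffic N m σ u ybar') ∧
      curveEffic N m σ u ybar' < 1 := by
  have hσ0 : 0 < σ := by linarith
  have : Nonempty (Fin N) := ⟨⟨0, hN⟩⟩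
  have hcomp := isCompact_optimalSphere hσ0 hm
  have key : ∀ y y' : ℝ → Fin N → ℝ, MemLam N σ y y' → (∫ t in (0:ℝ)..1, u (y' t)) ≠ 0 →
      ∃ R > 0, (fun _ : Fin N => (∫ t in (0:ℝ)..1, u (y' t)) / R) ∈
        convexHull ℝ (optimalSphere m σ) ∧
        (curveDissip N m σ u y' ≠ 0 → R ^ σ ≤ curveDissip N m σ u y') := by
    rintro y y' ⟨hy, hper, hint, -⟩ hU
    have hy0 : ∫ s in (0:ℝ)..1, y' s = 0 := by
      have := hy 1
      rwa [hper, left_eq_add] at this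
    have hui : IntervalIntegrable (fun t => u (y' t)) volume 0 1 := by
      by_contra h
      exact hU (integral_undef h)
    unfold curveDissip
    rw [intervalIntegrable_iff_integrableOn_Ioc_of_le zero_le_one, IntegrableOn] at hint hui
    simp only [integral_of_le zero_le_one] at hU hy0 ⊢
    let μ : Measure ℝ := volume.restrict (Set.Ioc 0 1)
    have : IsProbabilityMeasure μ := ⟨by simp [μ]⟩
    let w : ℝ → Fin N → ℝ := fun t i => y' t i + u (y' t)
    have hw : Integrable w μ := Integrable.of_eval fun i => (hint.eval i).add hui
    have hwU : ∫ t, w t ∂μ = fun _ => ∫ t, u (y' t) ∂μ := by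
      ext i
      rw [eval_integral fun i => hw.eval i, integral_add (hint.eval i) hui,
        ← eval_integral fun i => hint.eval i, hy0]
      simp [μ]
    have hopt : ∀ t, ∀ ξ : ℝ,
        weightedPowSum m σ (w t) ≤ weightedPowSum m σ fun i => w t i + ξ := fun t ξ => by
      simpa only [weightedPowSum, w, add_assoc] using hu (y' t) (u (y' t) + ξ)
    obtain ⟨hR, hmem⟩ := const_div_mem_convexHull_optimalSphere hσ0 hm hsum hw hopt hU hwU
    refine ⟨_, hR, hmem, fun hD => ?_⟩
    refine integral_weightedPowSum_rpow_rpow_le hσ hm hsum hw ?_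
    by_contra h
    exact hD (MeasureTheory.integral_undef h)
  let T : Set ℝ := {c | (fun _ : Fin N => c) ∈ convexHull ℝ (optimalSphere m σ)}
  have hTneg : ∀ c ∈ T, -c ∈ T := fun c hc => by
    have h : -(fun _ : Fin N => c) ∈ -convexHull ℝ (optimalSphere m σ) := by
      simpa [T] using hc
    rwa [← convexHull_neg, neg_optimalSphere] at h
  have hTabs : ∀ c ∈ T, |c| ∈ T := fun c hc => by
    rcases abs_choice c with h | h <;> rw [h]
    exacts [hc, hTneg c hc]
  have hTcomp : IsCompact T := by
    have hcl : IsClosed T := (isCompact_convexHull_of_isCompact hcomp).isClosed.preimage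
      (continuous_pi fun _ => continuous_id)
    refine (isCompact_Icc (a := -1) (b := 1)).of_isClosed_subset hcl fun c hc => ?_
    have h1 := lt_one_of_const_mem_convexHull hσ hm hsum hc
    have h2 := lt_one_of_const_mem_convexHull hσ hm hsum (hTneg c hc)
    constructor <;> linarith
  obtain ⟨z, z', hz, hzU⟩ := hmob
  obtain ⟨R₀, hR₀, hmem₀, -⟩ := key z z' hz hzU
  obtain ⟨ρ, hρT, hρmax⟩ := hTcomp.exists_isGreatest ⟨_, hmem₀⟩
  have hρ0 : 0 < ρ :=
    (abs_pos.2 (div_ne_zero hzU hR₀.ne')).trans_le (hρmax (hTabs _ hmem₀))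
  have hρ1 : ρ < 1 := lt_one_of_const_mem_convexHull hσ hm hsum hρT
  obtain ⟨w, hwm, hws, hwint⟩ := exists_measurable_integral_eq_of_mem_convexHull hcomp.isBounded hρT
  let w' : ℝ → Fin N → ℝ := fun t i => w t i - ρ
  have huw : ∀ t, u (w' t) = ρ := fun t => by
    refine (huniq _ _ fun ζ => ?_).symm
    have := (hws t).2 (ζ - ρ)
    simpa only [weightedPowSum, w', sub_add_cancel, sub_add_eq_add_sub, add_sub_assoc] using this
  have hD : curveDissip N m σ u w' = 1 := by
    have : ∀ t, ∑ i, m i * |w' t i + u (w' t)| ^ σ = 1 := fun t => by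
      rw [huw]
      simpa only [weightedPowSum, w', sub_add_cancel] using (hws t).1
    simp [curveDissip, this]
  have hE : curveEffic N m σ u w' = ρ ^ σ := by
    simp [curveEffic, hD, huw, abs_of_pos hρ0]
  obtain ⟨C, hC⟩ := hcomp.isBounded.exists_norm_le
  have hwi : IntervalIntegrable w volume 0 1 :=
    (intervalIntegrable_const (c := C)).mono_fun hwm.aestronglyMeasurable
      (.of_forall fun t => (hC _ (hws t)).trans (le_abs_self C))
  have hw'i : IntervalIntegrable w' volume 0 1 :=
    hwi.sub (intervalIntegrable_const (c := fun _ => ρ))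
  have hw'0 : ∫ t in (0 : ℝ)..1, w' t = 0 := by
    have : ∫ t in (0 : ℝ)..1, w' t = (∫ t in (0 : ℝ)..1, w t) - ∫ t in (0 : ℝ)..1, fun _ => ρ :=
      integral_sub hwi intervalIntegrable_const
    rw [this, hwint]
    simp
  refine ⟨fun t => ∫ s in (0 : ℝ)..t, w' s, w', ⟨fun t => by simp, by simp [hw'0], hw'i, ?_⟩,
    by simp [hD], fun y y' hy hDy => ?_, ?_⟩
  · obtain ⟨B, hB⟩ := hcomp.exists_bound_of_continuousOn
      (f := fun v => Real.sqrt (∑ i, (v i - ρ) ^ 2) ^ σ)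
      (Continuous.continuousOn <| Continuous.rpow_const (by fun_prop) fun _ => Or.inr hσ0.le)
    refine Measure.integrableOn_of_bounded (M := B) (by simp) ?_ (.of_forall fun t => hB _ (hws t))
    exact (Continuous.measurable <| Continuous.rpow_const
      (f := fun v : Fin N → ℝ => Real.sqrt (∑ i, (v i - ρ) ^ 2)) (by fun_prop)
      fun _ => Or.inr hσ0.le).comp hwm |>.aestronglyMeasurable
  · rw [hE]
    by_cases hU : ∫ t in (0 : ℝ)..1, u (y' t) = 0
    · rw [curveEffic, hU, abs_zero, Real.zero_rpow hσ0.ne', zero_div]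
      positivity
    · obtain ⟨R, hR, hmem, hRD⟩ := key y y' hy hU
      have h := hρmax (hTabs _ hmem)
      rw [abs_div, abs_of_pos hR, div_le_iff₀ hR] at h
      rw [curveEffic, div_le_iff₀ hDy]
      calc |∫ t in (0 : ℝ)..1, u (y' t)| ^ σ ≤ (ρ * R) ^ σ :=
            Real.rpow_le_rpow (abs_nonneg _) h hσ0.le
        _ = ρ ^ σ * R ^ σ := Real.mul_rpow hρ0.le hR.le
        _ ≤ ρ ^ σ * curveDissip N m σ u y' := by
            gcongr
            exact hRD hDy.ne'
  · rw [hE]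
    exact Real.rpow_lt_one hρ0.le hρ1 hσ0
end
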